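/- Let φ : H → V be a morphism of mixed Hodge structures with weight filtrations W and U respectively. Then φ is strict for the weight filtration: Im(φ) ∩ U_n(V) = φ(W_n(H)) for every n. -/

import Mathlib

open TensorProduct

/-- Complex conjugation on the complexification `ℂ ⊗[ℚ] V` of a ℚ-vector space. -/
noncomputable def complexConj (V : Type) [AddCommGroup V] [Module ℚ V] :
    (ℂ ⊗[ℚ] V) →ₗ[ℚ] (ℂ ⊗[ℚ] V) :=
  TensorProduct.map (Complex.conjAe.toLinearMap.restrictScalars ℚ) LinearMap.id

/-- The graded piece `Gr^W_n = W_n / W_{n-1}` of an increasing filtration. -/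
def grPiece {V : Type} [AddCommGroup V] [Module ℚ V] (W : ℤ → Submodule ℚ V) (n : ℤ) :=
  ↥(W n) ⧸ Submodule.comap (W n).subtype (W (n - 1))

instance {V : Type} [AddCommGroup V] [Module ℚ V] (W : ℤ → Submodule ℚ V) (n : ℤ) :
    AddCommGroup (grPiece W n) :=
  inferInstanceAs (AddCommGroup (↥(W n) ⧸ Submodule.comap (W n).subtype (W (n - 1))))

instance {V : Type} [AddCommGroup V] [Module ℚ V] (W : ℤ → Submodule ℚ V) (n : ℤ) :
    Module ℚ (grPiece W n) :=
  inferInstanceAs (Module ℚ (↥(W n) ⧸ Submodule.comap (W n).subtype (W (n - 1))))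

/-- The Hodge filtration induced on the complexified graded piece `ℂ ⊗ Gr^W_n`. -/
noncomputable def inducedF {V : Type} [AddCommGroup V] [Module ℚ V]
    (W : ℤ → Submodule ℚ V) (F : ℤ → Submodule ℂ (ℂ ⊗[ℚ] V)) (n p : ℤ) :
    Submodule ℂ (ℂ ⊗[ℚ] grPiece W n) :=
  Submodule.map
    (LinearMap.baseChange ℂ
      (Submodule.mkQ (Submodule.comap (W n).subtype (W (n - 1)))))
    (Submodule.comap (LinearMap.baseChange ℂ (W n).subtype) (F p))

/-- A (finite, exhaustive) decreasing filtration `FF` on `ℂ ⊗ M` defines a pure Hodge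
structure of weight `n` on the ℚ-vector space `M` iff `FF^p` and the conjugate of
`FF^q` are complementary whenever `p + q = n + 1` (n-opposed filtrations). -/
def IsPureHodgeOfWeight (M : Type) [AddCommGroup M] [Module ℚ M] (n : ℤ)
    (FF : ℤ → Submodule ℂ (ℂ ⊗[ℚ] M)) : Prop :=
  ∀ p q : ℤ, p + q = n + 1 →
    ((FF p).restrictScalars ℚ ⊓
        ((FF q).restrictScalars ℚ).map (complexConj M) = ⊥) ∧
    ((FF p).restrictScalars ℚ ⊔
        ((FF q).restrictScalars ℚ).map (complexConj M) = ⊤)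

/-- A mixed Hodge structure on a finite-dimensional ℚ-vector space `V`: an increasing
weight filtration `W` on `V` and a decreasing Hodge filtration `F` on `ℂ ⊗ V`
inducing a pure Hodge structure of weight `n` on each graded piece `Gr^W_n`. -/
structure MixedHodgeStructure (V : Type) [AddCommGroup V] [Module ℚ V]
    [FiniteDimensional ℚ V] where
  W : ℤ → Submodule ℚ V
  F : ℤ → Submodule ℂ (ℂ ⊗[ℚ] V)
  W_mono : Monotone W
  F_anti : Antitone F
  W_exhausts : ∃ n, W n = ⊤
  W_separates : ∃ n, W n = ⊥
  F_exhausts : ∃ p, F p = ⊤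
  F_separates : ∃ p, F p = ⊥
  pure_graded : ∀ n : ℤ, IsPureHodgeOfWeight (grPiece W n) n (inducedF W F n)

/-- Three filtrations `W`, `F`, `G` on a module such that `F` and `G` induce `n`-opposed filtrations
on each quotient `W n / W (n - 1)`. -/
structure OpposedOnGraded {k X : Type*} [Ring k] [AddCommGroup X] [Module k X]
    (W F G : ℤ → Submodule k X) : Prop where
  W_mono : Monotone W
  F_anti : Antitone F
  G_anti : Antitone G
  W_separates : ∃ n, W n = ⊥
  F_separates : ∃ p, F p = ⊥
  mem_of_sub_mem : ∀ {n p q : ℤ}, p + q = n + 1 → ∀ {f g : X}, f ∈ F p → f ∈ W n →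
    g ∈ G q → g ∈ W n → f - g ∈ W (n - 1) → f ∈ W (n - 1)
  exists_decomp : ∀ {n p q : ℤ}, p + q = n + 1 → ∀ {x : X}, x ∈ W n →
    ∃ f ∈ F p, f ∈ W n ∧ ∃ g ∈ G q, g ∈ W n ∧ x - f - g ∈ W (n - 1)

/-- The sum of the submodules `G (q - i) ⊓ W (n - i)` over `i ≥ 0`. -/
def diagonalSum {k X : Type*} [Ring k] [AddCommGroup X] [Module k X]
    (W G : ℤ → Submodule k X) (n q : ℤ) : Submodule k X :=
  ⨆ i : ℕ, G (q - i) ⊓ W (n - i)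

section

variable {k X Y : Type*} [Ring k] [AddCommGroup X] [Module k X] [AddCommGroup Y] [Module k Y]
  {W F G : ℤ → Submodule k X} {U F' G' : ℤ → Submodule k Y}

theorem diagonalSum_eq_sup (W G : ℤ → Submodule k X) (n q : ℤ) :
    diagonalSum W G n q = G q ⊓ W n ⊔ diagonalSum W G (n - 1) (q - 1) := by
  unfold diagonalSum
  rw [← sup_iSup_nat_succ]
  simp [sub_sub, add_comm]

theorem diagonalSum_le (hW : Monotone W) (n q : ℤ) : diagonalSum W G n q ≤ W n :=
  iSup_le fun i => inf_le_right.trans (hW (by omega))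

theorem map_diagonalSum_le {φ : X →ₗ[k] Y} (hW : ∀ n, (W n).map φ ≤ U n)
    (hG : ∀ q, (G q).map φ ≤ G' q) (n q : ℤ) :
    (diagonalSum W G n q).map φ ≤ diagonalSum U G' n q := by
  unfold diagonalSum
  rw [Submodule.map_iSup]
  exact iSup_mono fun i => (Submodule.map_inf_le _).trans (inf_le_inf (hG _) (hW _))

namespace OpposedOnGraded

theorem eq_zero_of_mem_diagonalSum (h : OpposedOnGraded W F G) {n p q : ℤ} (hpq : p + q = n + 1)
    {x : X} (hF : x ∈ F p) (hR : x ∈ diagonalSum W G n q) : x = 0 := by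
  obtain ⟨m, hm⟩ := h.W_separates
  by_cases hn : n ≤ m
  · have := h.W_mono hn (diagonalSum_le h.W_mono n q hR)
    rwa [hm, Submodule.mem_bot] at this
  push Not at hn
  induction n, hn.le using Int.leInduction generalizing q with
  | base => exact absurd hn (lt_irrefl _)
  | succ n hmn ih =>
    have hR' := hR
    rw [diagonalSum_eq_sup] at hR
    obtain ⟨g, ⟨hgG, hgW⟩, r, hr, rfl⟩ := Submodule.mem_sup.1 hR
    have hrW := diagonalSum_le h.W_mono _ _ hr
    have hx : g + r ∈ W (n + 1 - 1) :=
      h.mem_of_sub_mem hpq hF (diagonalSum_le h.W_mono _ _ hR') hgG hgW (by simpa using hrW)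
    have hg : g ∈ W (n + 1 - 1) := by simpa using sub_mem hx hrW
    have hR'' : g + r ∈ diagonalSum W G (n + 1 - 1) (q - 1) := by
      refine add_mem ?_ hr
      rw [diagonalSum_eq_sup]
      exact Submodule.mem_sup_left ⟨h.G_anti (by omega) hgG, hg⟩
    rw [add_sub_cancel_right] at hR''
    rcases hmn.eq_or_lt with rfl | hlt
    · have := diagonalSum_le h.W_mono _ _ hR''
      rwa [hm, Submodule.mem_bot] at this
    · exact ih (by omega) hR'' hlt

theorem le_sup_diagonalSum (h : OpposedOnGraded W F G) {n p q : ℤ} (hpq : p + q = n + 1) :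
    W n ≤ F p ⊓ W n ⊔ diagonalSum W G n q := by
  obtain ⟨m, hm⟩ := h.W_separates
  rcases le_total n m with hn | hn
  · exact (h.W_mono hn).trans (by simp [hm])
  induction n, hn using Int.leInduction generalizing q with
  | base => simp [hm]
  | succ n hmn ih =>
    intro x hx
    obtain ⟨f, hfF, hfW, g, hgG, hgW, hw⟩ := h.exists_decomp hpq hx
    rw [add_sub_cancel_right] at hw
    obtain ⟨f', ⟨hfF', hfW'⟩, r, hr, hfr⟩ :=
      Submodule.mem_sup.1 (ih (q := q - 1) (by omega) hw)
    refine Submodule.mem_sup.2 ⟨f + f', ⟨add_mem hfF hfF', add_mem hfW ?_⟩, g + r, ?_, ?_⟩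
    · exact h.W_mono (by omega) hfW'
    · rw [diagonalSum_eq_sup, add_sub_cancel_right]
      exact Submodule.add_mem_sup ⟨hgG, hgW⟩ hr
    · rw [add_add_add_comm, hfr]
      abel

/-- An element of `W n` whose class modulo `W (n - 1)` lies in `F p` and `G q`, with `p + q = n`,
is congruent modulo `W (n - 1)` to an element of Deligne's subspace `I^{p,q}`. -/
theorem exists_deligne_lift (h : OpposedOnGraded W F G) {n p q : ℤ} (hpq : p + q = n)
    {f g : X} (hfF : f ∈ F p) (hgG : g ∈ G q) (hgW : g ∈ W n) (hfg : f - g ∈ W (n - 1)) :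
    ∃ i ∈ F p, i ∈ G q ⊓ W n ⊔ diagonalSum W G (n - 2) (q - 1) ∧ f - i ∈ W (n - 1) := by
  obtain ⟨f', ⟨hfF', hfW'⟩, r, hr, hfr⟩ :=
    Submodule.mem_sup.1 (h.le_sup_diagonalSum (p := p) (q := q) (by omega) hfg)
  refine ⟨f - f', sub_mem hfF hfF', ?_, by simpa using hfW'⟩
  rw [diagonalSum_eq_sup, show n - 1 - 1 = n - 2 by ring] at hr
  have e : f - f' = g + r := by rw [sub_eq_iff_eq_add, add_assoc, add_comm r, hfr]; abel
  rw [e]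
  refine add_mem (Submodule.mem_sup_left ⟨hgG, hgW⟩) ?_
  exact sup_le_sup_right (inf_le_inf_left _ (h.W_mono (by omega))) _ hr

/-- Deligne's subspace `I^{p,q}` meets `W (p + q - 1)` trivially. -/
theorem eq_zero_of_mem_deligne (h : OpposedOnGraded W F G) {n p q : ℤ} (hpq : p + q = n)
    {i : X} (hF : i ∈ F p) (hI : i ∈ G q ⊓ W n ⊔ diagonalSum W G (n - 2) (q - 1))
    (hW : i ∈ W (n - 1)) : i = 0 := by
  refine h.eq_zero_of_mem_diagonalSum (n := n - 1) (q := q) (by omega) hF ?_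
  obtain ⟨g, ⟨hgG, hgW⟩, r, hr, rfl⟩ := Submodule.mem_sup.1 hI
  have hrW : r ∈ W (n - 1) := h.W_mono (by omega) (diagonalSum_le h.W_mono _ _ hr)
  rw [diagonalSum_eq_sup, show n - 1 - 1 = n - 2 by ring]
  exact Submodule.add_mem_sup ⟨hgG, by simpa using sub_mem hW hrW⟩ hr

theorem map_mem_map_sub_one (hX : OpposedOnGraded W F G) (hY : OpposedOnGraded U F' G')
    {φ : X →ₗ[k] Y} (hW : ∀ n, (W n).map φ ≤ U n) (hF : ∀ p, (F p).map φ ≤ F' p)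
    (hG : ∀ q, (G q).map φ ≤ G' q) {n p : ℤ} {x : X} (hxF : x ∈ F p) (hxW : x ∈ W n)
    (hx : φ x ∈ U (n - 1)) : φ x ∈ (W (n - 1)).map φ := by
  obtain ⟨s, hs⟩ := hX.F_separates
  rcases le_total s p with hsp | hps
  · have := hX.F_anti hsp hxF
    rw [hs, Submodule.mem_bot] at this
    simp [this]
  induction p, hps using Int.leInductionDown generalizing x with
  | base =>
    rw [hs, Submodule.mem_bot] at hxF
    simp [hxF]
  | pred p _ ih =>
    obtain ⟨f, hfF, hfW, g, hgG, hgW, hw⟩ :=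
      hX.exists_decomp (n := n) (p := p) (q := n + 1 - p) (by omega) hxW
    obtain ⟨i, hiF, hiI, hiW⟩ := hX.exists_deligne_lift (n := n) (p := p - 1) (q := n + 1 - p)
      (by omega) (sub_mem hxF (hX.F_anti (by omega) hfF)) hgG hgW hw
    have hφ : ∀ {m : ℤ} {y : X}, y ∈ W m → φ y ∈ U m := fun hy =>
      hW _ (Submodule.mem_map_of_mem hy)
    have hiW' := hφ hiW
    have hgW' := hφ hw
    simp only [map_sub] at hiW' hgW'
    have hfU : φ f ∈ U (n - 1) := by
      refine hY.mem_of_sub_mem (n := n) (p := p) (q := n + 1 - p) (g := -φ g) (by omega)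
        (hF _ (Submodule.mem_map_of_mem hfF)) (hφ hfW)
        (neg_mem (hG _ (Submodule.mem_map_of_mem hgG))) (neg_mem (hφ hgW)) ?_
      convert sub_mem hx hgW' using 1
      abel
    have hiU : φ i ∈ U (n - 1) := by
      convert sub_mem (sub_mem hx hfU) hiW' using 1
      abel
    have hi0 : φ i = 0 := by
      refine hY.eq_zero_of_mem_deligne (n := n) (p := p - 1) (q := n + 1 - p) (by omega)
        (hF _ (Submodule.mem_map_of_mem hiF)) ?_ hiU
      have := Submodule.mem_map_of_mem (f := φ) hiI
      rw [Submodule.map_sup] at this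
      exact sup_le_sup ((Submodule.map_inf_le _).trans (inf_le_inf (hG _) (hW _)))
        (map_diagonalSum_le hW hG _ _) this
    have hxe : φ x = φ f + φ (x - f - i) := by simp [hi0]
    rw [hxe]
    exact add_mem (ih hfF hfW hfU) (Submodule.mem_map_of_mem hiW)

/-- A morphism of modules with opposed filtrations on the graded pieces is strict for `W`. -/
theorem range_inf_le_map (hX : OpposedOnGraded W F G) (hY : OpposedOnGraded U F' G')
    (hWX : ∃ m, W m = ⊤) (hFX : ∃ p, F p = ⊤)
    {φ : X →ₗ[k] Y} (hW : ∀ n, (W n).map φ ≤ U n) (hF : ∀ p, (F p).map φ ≤ F' p)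
    (hG : ∀ q, (G q).map φ ≤ G' q) (n : ℤ) : LinearMap.range φ ⊓ U n ≤ (W n).map φ := by
  obtain ⟨m, hm⟩ := hWX
  obtain ⟨p, hp⟩ := hFX
  rcases le_total m n with hmn | hnm
  · rw [top_le_iff.1 (hm.ge.trans (hX.W_mono hmn)), Submodule.map_top]
    exact inf_le_left
  induction n, hnm using Int.leInductionDown with
  | base =>
    rw [hm, Submodule.map_top]
    exact inf_le_left
  | pred n _ ih =>
    rintro y ⟨hyr, hyU⟩
    obtain ⟨x, hx, rfl⟩ := ih ⟨hyr, hY.W_mono (by omega) hyU⟩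
    exact hX.map_mem_map_sub_one hY hW hF hG (p := p) (by simp [hp]) hx hyU

end OpposedOnGraded

end

section Complexification

variable {V V' : Type} [AddCommGroup V] [Module ℚ V] [AddCommGroup V'] [Module ℚ V']

theorem complexConj_complexConj (x : ℂ ⊗[ℚ] V) : complexConj V (complexConj V x) = x := by
  induction x with
  | zero => simp
  | tmul z v => simp [complexConj]
  | add x y hx hy => rw [map_add, map_add, hx, hy]

theorem baseChange_complexConj (f : V →ₗ[ℚ] V') (x : ℂ ⊗[ℚ] V) :
    f.baseChange ℂ (complexConj V x) = complexConj V' (f.baseChange ℂ x) := by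
  induction x with
  | zero => simp
  | tmul z v => simp [complexConj]
  | add x y hx hy => simp only [map_add, hx, hy]

theorem mem_baseChange_iff (S : Submodule ℚ V) (x : ℂ ⊗[ℚ] V) :
    x ∈ S.baseChange ℂ ↔ S.mkQ.baseChange ℂ x = 0 := by
  rw [Submodule.baseChange]
  exact (lTensor_exact ℂ (LinearMap.exact_subtype_mkQ S) S.mkQ_surjective x).symm

theorem one_tmul_mem_baseChange_iff {S : Submodule ℚ V} {v : V} :
    (1 : ℂ) ⊗ₜ[ℚ] v ∈ S.baseChange ℂ ↔ v ∈ S := by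
  refine ⟨fun h => ?_, fun h => Submodule.tmul_mem_baseChange_of_mem 1 h⟩
  rw [mem_baseChange_iff, LinearMap.baseChange_tmul] at h
  rw [← Submodule.Quotient.mk_eq_zero, ← Submodule.mkQ_apply]
  exact Module.FaithfullyFlat.tensorProduct_mk_injective (A := ℚ) (B := ℂ) (V ⧸ S)
    (by simpa using h)

theorem map_baseChange_le {f : V →ₗ[ℚ] V'} {S : Submodule ℚ V} {T : Submodule ℚ V'}
    (h : S.map f ≤ T) : (S.baseChange ℂ).map (f.baseChange ℂ) ≤ T.baseChange ℂ := by
  rw [Submodule.baseChange_eq_span, Submodule.map_span, Submodule.span_le]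
  rintro _ ⟨_, ⟨v, hv, rfl⟩, rfl⟩
  exact one_tmul_mem_baseChange_iff.2 (h (Submodule.mem_map_of_mem hv))

theorem complexConj_mem_baseChange {S : Submodule ℚ V} {x : ℂ ⊗[ℚ] V}
    (hx : x ∈ S.baseChange ℂ) : complexConj V x ∈ S.baseChange ℂ := by
  rw [Submodule.baseChange] at hx ⊢
  obtain ⟨y, rfl⟩ := hx
  exact ⟨complexConj S y, baseChange_complexConj _ _⟩

/-- The kernel of `ℂ ⊗ S → ℂ ⊗ (S / (S ∩ T))` is the preimage of the complexification of `T`. -/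
theorem baseChange_mkQ_eq_zero_iff (S T : Submodule ℚ V) (x : ℂ ⊗[ℚ] S) :
    (T.comap S.subtype).mkQ.baseChange ℂ x = 0 ↔ S.subtype.baseChange ℂ x ∈ T.baseChange ℂ := by
  have hinj : Function.Injective ((T.comap S.subtype).mapQ T S.subtype le_rfl) := by
    rw [← LinearMap.ker_eq_bot, Submodule.mapQ, Submodule.ker_liftQ_eq_bot]
    rw [LinearMap.ker_comp, Submodule.ker_mkQ]
  have hinj' : Function.Injective
      (((T.comap S.subtype).mapQ T S.subtype le_rfl).baseChange ℂ) :=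
    Module.Flat.lTensor_preserves_injective_linearMap _ hinj
  rw [mem_baseChange_iff, ← map_eq_zero_iff _ hinj', ← LinearMap.comp_apply,
    ← LinearMap.comp_apply, ← LinearMap.baseChange_comp, ← LinearMap.baseChange_comp,
    Submodule.mapQ_mkQ]

end Complexification

theorem MixedHodgeStructure.opposedOnGraded {V : Type} [AddCommGroup V] [Module ℚ V]
    [FiniteDimensional ℚ V] (A : MixedHodgeStructure V) :
    OpposedOnGraded (fun n => ((A.W n).baseChange ℂ).restrictScalars ℚ)
      (fun p => (A.F p).restrictScalars ℚ)
      (fun q => ((A.F q).restrictScalars ℚ).map (complexConj V)) where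
  W_mono m n h := Submodule.baseChange_mono ℂ (A.W_mono h)
  F_anti m n h := A.F_anti h
  G_anti m n h := Submodule.map_mono (A.F_anti h)
  W_separates := A.W_separates.imp fun n hn => by simp [hn]
  F_separates := A.F_separates.imp fun n hn => by simp [hn]
  mem_of_sub_mem := by
    rintro n p q hpq f g hfF hfW ⟨g', hgF, rfl⟩ hgW hfg
    simp only [Submodule.restrictScalars_mem] at *
    have hgW' := complexConj_mem_baseChange hgW
    rw [complexConj_complexConj] at hgW'
    rw [Submodule.baseChange] at hfW hgW'
    obtain ⟨f, rfl⟩ := hfW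
    obtain ⟨g, rfl⟩ := hgW'
    rw [← baseChange_complexConj, ← map_sub, ← baseChange_mkQ_eq_zero_iff, map_sub,
      sub_eq_zero, baseChange_complexConj] at hfg
    rw [← baseChange_mkQ_eq_zero_iff]
    have := (A.pure_graded n p q hpq).1.le
      ⟨Submodule.mem_map_of_mem (p := (A.F p).comap ((A.W n).subtype.baseChange ℂ)) hfF,
        _, Submodule.mem_map_of_mem (p := (A.F q).comap ((A.W n).subtype.baseChange ℂ)) hgF,
        hfg.symm⟩
    exact this
  exists_decomp := by
    intro n p q hpq x hx
    simp only [Submodule.restrictScalars_mem, Submodule.baseChange] at hx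
    obtain ⟨x, rfl⟩ := hx
    obtain ⟨_, ⟨f, hf, rfl⟩, _, ⟨_, ⟨g, hg, rfl⟩, rfl⟩, hfg⟩ := Submodule.mem_sup.1
      ((A.pure_graded n p q hpq).2.ge
        (Submodule.mem_top (x := ((A.W (n - 1)).comap (A.W n).subtype).mkQ.baseChange ℂ x)))
    refine ⟨_, hf, ?_, _, ⟨_, hg, rfl⟩, ?_, ?_⟩
    · simp [Submodule.baseChange]
    · rw [← baseChange_complexConj]
      simp [Submodule.baseChange]
    · rw [← baseChange_complexConj, ← map_sub, ← map_sub, Submodule.restrictScalars_mem,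
        ← baseChange_mkQ_eq_zero_iff, map_sub, map_sub, baseChange_complexConj, sub_sub,
        sub_eq_zero]
      exact hfg.symm

/-- Deligne's strictness theorem (weight filtration part): a morphism of mixed Hodge
structures is strict for the weight filtrations, `Im(φ) ∩ U_n = φ(W_n)`. -/
theorem morphism_of_mhs_strict_for_weight_filtration
    {H V : Type} [AddCommGroup H] [Module ℚ H] [FiniteDimensional ℚ H]
    [AddCommGroup V] [Module ℚ V] [FiniteDimensional ℚ V]
    (A : MixedHodgeStructure H) (B : MixedHodgeStructure V)
    (φ : H →ₗ[ℚ] V)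
    (hW : ∀ n : ℤ, (A.W n).map φ ≤ B.W n)
    (hF : ∀ p : ℤ, (A.F p).map (LinearMap.baseChange ℂ φ) ≤ B.F p) :
    ∀ n : ℤ, LinearMap.range φ ⊓ B.W n = (A.W n).map φ := by
  refine fun n => le_antisymm ?_ (le_inf LinearMap.map_le_range (hW n))
  rintro _ ⟨⟨x, rfl⟩, hx⟩
  have key := A.opposedOnGraded.range_inf_le_map B.opposedOnGraded
    (A.W_exhausts.imp fun m hm => by simp [hm]) (A.F_exhausts.imp fun p hp => by simp [hp])
    (φ := (φ.baseChange ℂ).restrictScalars ℚ) (fun m => map_baseChange_le (hW m)) hF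
    (by
      rintro q _ ⟨_, ⟨y, hy, rfl⟩, rfl⟩
      exact ⟨_, hF q (Submodule.mem_map_of_mem hy), (baseChange_complexConj φ y).symm⟩) n
    ⟨⟨1 ⊗ₜ x, by simp⟩, one_tmul_mem_baseChange_iff.2 hx⟩
  rw [← one_tmul_mem_baseChange_iff]
  exact map_baseChange_le le_rfl key
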